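/- (Orbit intersection lemma.) Let α be a nonempty finite type and let F : α → Finset α be such that F(a) is nonempty for every a. Extend F to finite sets by F̂(S) = ⋃_{a ∈ S} F(a), and define the orbit of a as 𝒪(a) = ⋃_{k ≥ 0} F̂^k({a}). If a, b ∈ α satisfy 𝒪(a) ∩ 𝒪(b) ≠ ∅, then there exists c ∈ α such that c ∈ F̂^m({c}) for some integer 1 ≤ m ≤ card(α) and 𝒪(c) ⊆ 𝒪(a) ∩ 𝒪(b). -/

import Mathlib

open Finset

/-- The extension of `F : α → Finset α` to finite sets: `F̂(S) = ⋃_{a ∈ S} F(a)`. -/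
def setImage {α : Type*} [DecidableEq α] (F : α → Finset α) (S : Finset α) : Finset α :=
  S.biUnion F

/-- The orbit of `a` under the iterates of `F̂`: `𝒪(a) = ⋃_{k ≥ 0} F̂^k({a})`. -/
def orbitOf {α : Type*} [DecidableEq α] (F : α → Finset α) (a : α) : Set α :=
  {b | ∃ k : ℕ, b ∈ (setImage F)^[k] {a}}

theorem mem_iterate_setImage_trans {α : Type*} [DecidableEq α] {F : α → Finset α} {x y z : α}
    {k n : ℕ} (hy : y ∈ (setImage F)^[k] {x}) (hz : z ∈ (setImage F)^[n] {y}) :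
    z ∈ (setImage F)^[k + n] {x} := by
  induction n generalizing z with
  | zero =>
    obtain rfl : z = y := by simpa using hz
    exact hy
  | succ n ih =>
    rw [Function.iterate_succ_apply', setImage, Finset.mem_biUnion] at hz
    obtain ⟨w, hw, hzw⟩ := hz
    rw [← Nat.add_assoc, Function.iterate_succ_apply', setImage, Finset.mem_biUnion]
    exact ⟨w, ih hw, hzw⟩

theorem orbitOf_subset_of_mem {α : Type*} [DecidableEq α] {F : α → Finset α} {x y : α}
    (hy : y ∈ orbitOf F x) : orbitOf F y ⊆ orbitOf F x := by
  obtain ⟨k, hk⟩ := hy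
  rintro z ⟨n, hn⟩
  exact ⟨k + n, mem_iterate_setImage_trans hk hn⟩

theorem iterate_mem_iterate_setImage {α : Type*} [DecidableEq α] {F : α → Finset α} {g : α → α}
    (hg : ∀ x, g x ∈ F x) (x : α) (n : ℕ) : g^[n] x ∈ (setImage F)^[n] {x} := by
  induction n with
  | zero => simp
  | succ n ih =>
    rw [Function.iterate_succ_apply', Function.iterate_succ_apply', setImage, Finset.mem_biUnion]
    exact ⟨_, ih, hg _⟩

/-- **Orbit intersection lemma.** If `α` is a nonempty finite type,
`F : α → Finset α` has nonempty values, and the orbits of `a` and `b` intersect, then there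
is a periodic `c` (i.e. `c ∈ F̂^m({c})` for some `1 ≤ m ≤ card α`) with
`𝒪(c) ⊆ 𝒪(a) ∩ 𝒪(b)`. -/
theorem orbit_intersection
    (α : Type*) [Fintype α] [Nonempty α] [DecidableEq α]
    (F : α → Finset α) (hF : ∀ a, (F a).Nonempty)
    (a b : α) (hab : (orbitOf F a ∩ orbitOf F b).Nonempty) :
    ∃ c : α, (∃ m : ℕ, 1 ≤ m ∧ m ≤ Fintype.card α ∧ c ∈ (setImage F)^[m] {c}) ∧
      orbitOf F c ⊆ orbitOf F a ∩ orbitOf F b := by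
  choose g hg using hF
  obtain ⟨x, hxa, hxb⟩ := hab
  obtain ⟨i, j, hij, heq⟩ : ∃ i j : Fin (Fintype.card α + 1), i < j ∧ g^[i] x = g^[j] x := by
    obtain ⟨i, j, hne, heq⟩ := Fintype.exists_ne_map_eq_of_card_lt
      (fun i : Fin (Fintype.card α + 1) => g^[i] x) (by simp)
    rcases lt_or_gt_of_ne hne with h | h
    · exact ⟨i, j, h, heq⟩
    · exact ⟨j, i, h, heq.symm⟩
  have hlt : (i : ℕ) < j := hij
  have hcx : g^[i] x ∈ orbitOf F x := ⟨i, iterate_mem_iterate_setImage hg x i⟩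
  refine ⟨g^[i] x, ⟨j - i, by omega, by omega, ?_⟩, fun z hz => ?_⟩
  · have h := iterate_mem_iterate_setImage hg (g^[i] x) (j - i)
    rwa [← Function.iterate_add_apply, Nat.sub_add_cancel hlt.le, ← heq] at h
  · have hzx := orbitOf_subset_of_mem hcx hz
    exact ⟨orbitOf_subset_of_mem hxa hzx, orbitOf_subset_of_mem hxb hzx⟩
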